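/- Let d ≥ 1 and ξ ≥ 0, and for each i ∈ {1,…,d} let D_i and D̂_i be probability measures on ℝ with Kolmogorov distance ||D_i − D̂_i||_K ≤ ξ. Then every convex set E ⊆ ℝ^d is single-intersecting, and consequently for every Borel measurable convex set E ⊆ ℝ^d, |(∏_{i=1}^d D_i)(E) − (∏_{i=1}^d D̂_i)(E)| ≤ 2ξd. -/

import Mathlib

open MeasureTheory

/-- A set `E ⊆ ℝ^d` is *single-intersecting* if its intersection with every axis-parallel
line is order-connected (an interval, possibly empty, a point, or unbounded). -/
def SingleIntersecting {d : ℕ} (E : Set (Fin d → ℝ)) : Prop :=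
  ∀ (i : Fin d) (a : Fin d → ℝ), ({x : ℝ | Function.update a i x ∈ E}).OrdConnected

lemma lower_set_bound (μ ν : Measure ℝ) [IsProbabilityMeasure μ] [IsProbabilityMeasure ν]
    (ξ : ℝ) (hξ : 0 ≤ ξ)
    (h : ∀ x, |(μ (Set.Iic x)).toReal - (ν (Set.Iic x)).toReal| ≤ ξ)
    (L : Set ℝ) (hL : IsLowerSet L) :
    MeasurableSet L ∧ |(μ L).toReal - (ν L).toReal| ≤ ξ := by
  rcases L.eq_empty_or_nonempty with rfl | hne
  · simpa using hξ
  by_cases hb : BddAbove L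
  · have hlt : ∀ x, x < sSup L → x ∈ L := by
      intro x hx
      obtain ⟨y, hy, hxy⟩ := exists_lt_of_lt_csSup hne hx
      exact hL hxy.le hy
    by_cases hs : sSup L ∈ L
    · have : L = Set.Iic (sSup L) := by
        ext x
        exact ⟨fun hx => le_csSup hb hx, fun hx => hL hx hs⟩
      rw [this]
      exact ⟨measurableSet_Iic, h _⟩
    · have : L = Set.Iio (sSup L) := by
        ext x
        refine ⟨fun hx => lt_of_le_of_ne (le_csSup hb hx) ?_, fun hx => hlt x hx⟩
        rintro rfl
        exact hs hx
      rw [this]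
      refine ⟨measurableSet_Iio, ?_⟩
      obtain ⟨u, hu, hua, hlim⟩ := exists_seq_strictMono_tendsto (sSup L)
      have hU : Set.Iio (sSup L) = ⋃ n, Set.Iic (u n) := by
        ext x
        simp only [Set.mem_Iio, Set.mem_iUnion, Set.mem_Iic]
        constructor
        · intro hx
          obtain ⟨n, hn⟩ := (hlim.eventually (lt_mem_nhds hx)).exists
          exact ⟨n, hn.le⟩
        · rintro ⟨n, hn⟩
          exact lt_of_le_of_lt hn (hua n)
      have hm : Monotone fun n => Set.Iic (u n) :=
        fun a b hab => Set.Iic_subset_Iic.2 (hu.monotone hab)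
      have h1 := (ENNReal.tendsto_toReal (measure_ne_top μ _)).comp
        (tendsto_measure_iUnion_atTop (μ := μ) hm)
      have h2 := (ENNReal.tendsto_toReal (measure_ne_top ν _)).comp
        (tendsto_measure_iUnion_atTop (μ := ν) hm)
      rw [hU]
      exact le_of_tendsto (h1.sub h2).abs (Filter.Eventually.of_forall fun n => h (u n))
  · have : L = Set.univ := by
      ext x
      simp only [Set.mem_univ, iff_true]
      obtain ⟨y, hy, hxy⟩ := not_bddAbove_iff.1 hb x
      exact hL hxy.le hy
    rw [this]
    simpa using hξ

lemma interval_bound (μ ν : Measure ℝ) [IsProbabilityMeasure μ] [IsProbabilityMeasure ν]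
    (ξ : ℝ) (hξ : 0 ≤ ξ)
    (h : ∀ x, |(μ (Set.Iic x)).toReal - (ν (Set.Iic x)).toReal| ≤ ξ)
    (I : Set ℝ) (hI : I.OrdConnected) :
    μ I ≤ ν I + ENNReal.ofReal (2 * ξ) := by
  rcases I.eq_empty_or_nonempty with rfl | ⟨z, hz⟩
  · simp
  have hL : IsLowerSet {x | ∃ y ∈ I, x ≤ y} := by
    rintro a b hab ⟨y, hy, hay⟩
    exact ⟨y, hy, hab.trans hay⟩
  have hM : IsLowerSet {x | ∀ y ∈ I, x < y} := by
    intro a b hab ha y hy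
    exact lt_of_le_of_lt hab (ha y hy)
  have hsub : {x | ∀ y ∈ I, x < y} ⊆ {x | ∃ y ∈ I, x ≤ y} :=
    fun x hx => ⟨z, hz, (hx z hz).le⟩
  have hEq : I = {x | ∃ y ∈ I, x ≤ y} \ {x | ∀ y ∈ I, x < y} := by
    ext x
    constructor
    · intro hx
      exact ⟨⟨x, hx, le_rfl⟩, fun hh => lt_irrefl _ (hh x hx)⟩
    · rintro ⟨⟨y, hy, hxy⟩, hn⟩
      simp only [Set.mem_ofPred_eq, not_forall, not_lt] at hn
      obtain ⟨w, hw, hwx⟩ := hn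
      exact hI.out hw hy ⟨hwx, hxy⟩
  obtain ⟨mL, bL⟩ := lower_set_bound μ ν ξ hξ h _ hL
  obtain ⟨mM, bM⟩ := lower_set_bound μ ν ξ hξ h _ hM
  have e1 := measureReal_sdiff (μ := μ) hsub mM
  have e2 := measureReal_sdiff (μ := ν) hsub mM
  rw [← hEq] at e1 e2
  simp only [measureReal_def] at e1 e2
  rw [← ENNReal.toReal_le_toReal (measure_ne_top _ _) (by finiteness),
    ENNReal.toReal_add (measure_ne_top _ _) (by finiteness),
    ENNReal.toReal_ofReal (by positivity), e1, e2]
  have := abs_le.1 bL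
  have := abs_le.1 bM
  linarith

lemma pi_bound (c : ENNReal) : ∀ (n : ℕ) (D Dhat : Fin n → Measure ℝ)
    [∀ i, IsProbabilityMeasure (D i)] [∀ i, IsProbabilityMeasure (Dhat i)]
    (_ : ∀ i (I : Set ℝ), I.OrdConnected → D i I ≤ Dhat i I + c)
    (E : Set (Fin n → ℝ)), MeasurableSet E → SingleIntersecting E →
    Measure.pi D E ≤ Measure.pi Dhat E + n * c := by
  intro n
  induction n with
  | zero =>
    intro D Dhat _ _ _ E _ _
    rw [Subsingleton.elim D Dhat]
    exact le_self_add
  | succ n ih =>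
    intro D Dhat _ _ h E hE hs
    let e := MeasurableEquiv.piFinSuccAbove (fun _ : Fin (n + 1) => ℝ) 0
    have key : ∀ F : Fin (n + 1) → Measure ℝ, (∀ i, IsProbabilityMeasure (F i)) →
        Measure.pi F E = ((F 0).prod (Measure.pi fun j => F (Fin.succ j))) (e.symm ⁻¹' E) := by
      intro F _
      have := (measurePreserving_piFinSuccAbove F 0).symm
      exact (this.measure_preimage_equiv E).symm
    have he : ∀ x y, e.symm (x, y) = (Fin.cons x y : Fin (n + 1) → ℝ) := by
      intro x y
      simp [e, MeasurableEquiv.piFinSuccAbove]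
      rfl
    rw [key D inferInstance, key Dhat inferInstance]
    have hS : MeasurableSet (e.symm ⁻¹' E) := e.symm.measurable hE
    set S := e.symm ⁻¹' E with hSdef
    set P := Measure.pi fun j : Fin n => D (Fin.succ j)
    set Q := Measure.pi fun j : Fin n => Dhat (Fin.succ j)
    have s1 : ((D 0).prod P) S ≤ ((Dhat 0).prod P) S + c := by
      rw [Measure.prod_apply_symm hS, Measure.prod_apply_symm hS]
      calc _ ≤ ∫⁻ y, (Dhat 0 ((fun x => (x, y)) ⁻¹' S) + c) ∂P := by
            refine lintegral_mono fun y => h 0 _ ?_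
            have := hs 0 (Fin.cons 0 y)
            simpa [hSdef, Set.preimage, he, Fin.update_cons_zero] using this
        _ = _ := by rw [lintegral_add_right _ measurable_const]; simp
    have s2 : ((Dhat 0).prod P) S ≤ ((Dhat 0).prod Q) S + n * c := by
      rw [Measure.prod_apply hS, Measure.prod_apply hS]
      calc _ ≤ ∫⁻ x, (Q (Prod.mk x ⁻¹' S) + n * c) ∂(Dhat 0) := by
            refine lintegral_mono fun x => ih _ _ (fun i => h i.succ) _
              (measurable_prodMk_left hS) ?_
            intro i a
            have := hs i.succ (Fin.cons x a)
            simpa [hSdef, Set.preimage, he, Fin.cons_update] using this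
        _ = _ := by rw [lintegral_add_right _ measurable_const]; simp
    calc _ ≤ _ := s1
      _ ≤ _ := add_le_add_left s2 c
      _ = _ := by push_cast; ring

lemma convex_single {d : ℕ} (E : Set (Fin d → ℝ)) (hE : Convex ℝ E) :
    SingleIntersecting E := by
  intro i a
  apply Convex.ordConnected
  intro x hx y hy s t hs ht hst
  have := hE hx hy hs ht hst
  simp only [Set.mem_ofPred_eq]
  convert this using 1
  ext j
  by_cases hj : j = i
  · subst hj; simp
  · simp [hj, ← add_mul, hst]

/-- Every convex set `E ⊆ ℝ^d` is single-intersecting; consequently, if the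
coordinate marginals `D i` and `Dhat i` are within `ξ` in Kolmogorov distance for every `i`,
the two product measures differ by at most `2ξd` on every Borel measurable convex set. -/
theorem convex_singleIntersecting_and_product_measure_stability
    {d : ℕ} (hd : 1 ≤ d) (ξ : ℝ) (hξ : 0 ≤ ξ)
    (D Dhat : Fin d → Measure ℝ)
    [∀ i, IsProbabilityMeasure (D i)] [∀ i, IsProbabilityMeasure (Dhat i)]
    (hK : ∀ (i : Fin d) (x : ℝ),
      |((D i) (Set.Iic x)).toReal - ((Dhat i) (Set.Iic x)).toReal| ≤ ξ) :
    (∀ E : Set (Fin d → ℝ), Convex ℝ E → SingleIntersecting E) ∧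
    (∀ E : Set (Fin d → ℝ), MeasurableSet E → Convex ℝ E →
      |((Measure.pi D) E).toReal - ((Measure.pi Dhat) E).toReal| ≤ 2 * ξ * d) := by
  refine ⟨convex_single, fun E hm hc => ?_⟩
  have hs := convex_single E hc
  have hK' : ∀ (i : Fin d) (x : ℝ),
      |((Dhat i) (Set.Iic x)).toReal - ((D i) (Set.Iic x)).toReal| ≤ ξ := by
    intro i x
    rw [abs_sub_comm]
    exact hK i x
  have h1 := pi_bound _ d D Dhat (fun i => interval_bound _ _ ξ hξ (hK i)) E hm hs
  have h2 := pi_bound _ d Dhat D (fun i => interval_bound _ _ ξ hξ (hK' i)) E hm hs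
  have conv : ∀ a b : ENNReal, a ≠ ⊤ → b ≠ ⊤ → a ≤ b + d * ENNReal.ofReal (2 * ξ) →
      a.toReal ≤ b.toReal + 2 * ξ * d := by
    intro a b ha hb hab
    have := ENNReal.toReal_mono (by finiteness) hab
    rw [ENNReal.toReal_add hb (by finiteness), ENNReal.toReal_mul, ENNReal.toReal_natCast,
      ENNReal.toReal_ofReal (by positivity)] at this
    linarith
  have g1 := conv _ _ (measure_ne_top _ _) (measure_ne_top _ _) h1
  have g2 := conv _ _ (measure_ne_top _ _) (measure_ne_top _ _) h2
  rw [abs_le]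
  constructor <;> linarith
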